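/- Let G be a λ-edge-connected graph, and let H be a subgraph of G with t ≥ 2 connected components. If G̃ is a subgraph of G that contains at most |S|/2 edges in each edge-cut S of G, then at least λ·t/4 edges of E(G) \ E(G̃) join two distinct components of H. -/

import Mathlib

open Finset SimpleGraph
open scoped Classical

/-- The edge-cut of `G` determined by a vertex set `A`: the edges of `G` with exactly one
endpoint in `A`. -/
noncomputable def edgeCut {V : Type*} [Fintype V] (G : SimpleGraph V) (A : Finset V) :
    Finset (Sym2 V) :=
  G.edgeFinset.filter fun e => ∃ u v, e = s(u, v) ∧ u ∈ A ∧ v ∉ A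

theorem mem_edgeCut {V : Type*} [Fintype V] {G : SimpleGraph V} {A : Finset V} {e : Sym2 V} :
    e ∈ edgeCut G A ↔ e ∈ G.edgeSet ∧ ∃ u v, e = s(u, v) ∧ u ∈ A ∧ v ∉ A := by
  simp [edgeCut]

/-- An edge lies in the cuts of at most two classes of a vertex partition. -/
theorem card_filter_mem_edgeCut_fiber_le_two {V C : Type*} [Fintype V] [DecidableEq V]
    [Fintype C] [DecidableEq C]
    (G : SimpleGraph V) (f : V → C) (e : Sym2 V) :
    (univ.filter fun c => e ∈ edgeCut G (univ.filter fun v => f v = c)).card ≤ 2 := by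
  induction e using Sym2.ind with
  | _ x y =>
    refine (card_le_card (t := {f x, f y}) fun c hc => ?_).trans card_le_two
    obtain ⟨-, u, v, huv, hu, -⟩ := mem_edgeCut.1 (mem_filter.1 hc).2
    have hu : f u = c := by simpa using hu
    rcases Sym2.eq_iff.1 huv with ⟨rfl, rfl⟩ | ⟨rfl, rfl⟩ <;> simp [hu]

theorem le_two_mul_card_edgeCut_sdiff {V : Type*} [Fintype V] [DecidableEq V] {G G' : SimpleGraph V}
    {A : Finset V} {k : ℕ} (hk : k ≤ (edgeCut G A).card)
    (hcut : 2 * (edgeCut G' A).card ≤ (edgeCut G A).card) :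
    k ≤ 2 * (edgeCut G A \ edgeCut G' A).card := by
  have := le_card_sdiff (edgeCut G' A) (edgeCut G A)
  omega

/-- Let `G` be a `λ`-edge-connected graph, let `H` be a subgraph of `G` with `t ≥ 2`
connected components, and let `G̃` be a subgraph of `G` containing at most `|S|/2` edges
in each edge-cut `S` of `G`. Then at least `λ·t/4` edges of `E(G) \ E(G̃)` join two
distinct components of `H`. -/
theorem many_edges_join_components {V : Type*} [Fintype V] [DecidableEq V]
    (G H Gt : SimpleGraph V) (lam t : ℕ)
    (hconn : ∀ A : Finset V, A.Nonempty → A ≠ Finset.univ → lam ≤ (edgeCut G A).card)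
    (hHG : H ≤ G)
    (ht : t = Nat.card H.ConnectedComponent) (ht2 : 2 ≤ t)
    (hGtG : Gt ≤ G)
    (hcut : ∀ A : Finset V, A.Nonempty → A ≠ Finset.univ →
      2 * (edgeCut Gt A).card ≤ (edgeCut G A).card) :
    (lam * t : ℝ) / 4 ≤
      (((G.edgeFinset \ Gt.edgeFinset).filter fun e =>
        ∃ u v, e = s(u, v) ∧ H.connectedComponentMk u ≠ H.connectedComponentMk v).card : ℝ) := by
  set F := (G.edgeFinset \ Gt.edgeFinset).filter fun e =>
    ∃ u v, e = s(u, v) ∧ H.connectedComponentMk u ≠ H.connectedComponentMk v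
  let A : H.ConnectedComponent → Finset V :=
    fun c => univ.filter fun v => H.connectedComponentMk v = c
  have hcard : Fintype.card H.ConnectedComponent = t := by rw [ht, Nat.card_eq_fintype_card]
  have : Nontrivial H.ConnectedComponent :=
    Fintype.one_lt_card_iff_nontrivial.1 (by omega)
  have hA (c) : (A c).Nonempty ∧ A c ≠ univ := by
    obtain ⟨d, hd⟩ := exists_ne c
    obtain ⟨u, rfl⟩ := c.exists_rep
    obtain ⟨v, rfl⟩ := d.exists_rep
    refine ⟨⟨u, mem_filter.2 ⟨mem_univ u, rfl⟩⟩, fun h => hd ?_⟩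
    exact (mem_filter.1 (h ▸ mem_univ v : v ∈ A _)).2
  have hlower (c) : lam ≤ 2 * (F.filter fun e => e ∈ edgeCut G (A c)).card := by
    refine (le_two_mul_card_edgeCut_sdiff (hconn _ (hA c).1 (hA c).2)
      (hcut _ (hA c).1 (hA c).2)).trans (Nat.mul_le_mul_left 2 (card_le_card fun e he => ?_))
    obtain ⟨heG, heGt⟩ := mem_sdiff.1 he
    obtain ⟨hG, u, v, huv, hu, hv⟩ := mem_edgeCut.1 heG
    have hnot : e ∉ Gt.edgeSet := fun h => heGt (mem_edgeCut.2 ⟨h, u, v, huv, hu, hv⟩)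
    have hne : H.connectedComponentMk u ≠ H.connectedComponentMk v := fun h =>
      hv (mem_filter.2 ⟨mem_univ v, h.symm.trans (mem_filter.1 hu).2⟩)
    refine mem_filter.2 ⟨mem_filter.2 ⟨mem_sdiff.2 ⟨?_, ?_⟩, u, v, huv, hne⟩, heG⟩
    · exact mem_edgeFinset.2 hG
    · exact fun h => hnot (mem_edgeFinset.1 h)
  have hdouble : ∑ c, (F.filter fun e => e ∈ edgeCut G (A c)).card ≤ F.card * 2 := by
    refine (sum_card_bipartiteAbove_eq_sum_card_bipartiteBelow
      (fun c e => e ∈ edgeCut G (A c))).trans_le (sum_le_card_nsmul _ _ _ fun e _ => ?_)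
    exact card_filter_mem_edgeCut_fiber_le_two G H.connectedComponentMk e
  have hsum : t * lam ≤ 2 * ∑ c, (F.filter fun e => e ∈ edgeCut G (A c)).card := by
    rw [mul_sum, ← hcard, ← smul_eq_mul, ← card_univ]
    exact card_nsmul_le_sum _ _ _ fun c _ => hlower c
  have hmain : ((t * lam : ℕ) : ℝ) ≤ ((4 * F.card : ℕ) : ℝ) := by
    exact_mod_cast (by omega : t * lam ≤ 4 * F.card)
  push_cast at hmain
  linarith
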